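/- Let (G,w) be a road network, S a scope mapping of it, and E = {E_1,…,E_ℓ} a partition of E(G). For any s,t ∈ Γ(G,E), the minimum weight of a walk from s to t in G^[∞] equals the distance from s to t in the boundary graph B_E with its weighting p. -/

import Mathlib

open scoped ENNReal
open Classical

/-- A directed multigraph: edges are abstract objects equipped with a source and
a destination vertex. -/
structure RNGraph (V : Type) (E : Type) where
  src : E → V
  dst : E → V

namespace RNGraph

variable {V E : Type}

/-- The reverse graph `G^R`: same vertices, all edges reversed. -/
def reverse (G : RNGraph V E) : RNGraph V E := ⟨G.dst, G.src⟩

/-- `G.IsWalkFrom s t P` : the list of edges `P` forms a walk from `s` to `t` in `G`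
(the zero-length walk from `s` to `s` corresponds to `P = []`). -/
def IsWalkFrom (G : RNGraph V E) : V → V → List E → Prop
  | s, t, [] => s = t
  | s, t, e :: P => G.src e = s ∧ G.IsWalkFrom (G.dst e) t P

end RNGraph

/-- The weight `|P|_w` of a walk: the sum of its edge weights (with multiplicity). -/
def wsum {E : Type} (w : E → ℝ) (P : List E) : ℝ := (P.map w).sum

/-- A partition of the edge set of `G`, given by the function `cell` assigning to each
edge the (index of the) part it belongs to; the cell `C_i` is the subgraph induced by
the edge set `{e | cell e = i}`.  The cell boundary `Γ(C_i)` is the set of vertices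
incident both with some edge of the part `i` and with some edge outside the part `i`. -/
def cellBoundary {V E ι : Type} (G : RNGraph V E) (cell : E → ι) (i : ι) : Set V :=
  {v | (∃ e, cell e = i ∧ (G.src e = v ∨ G.dst e = v)) ∧
       (∃ e, cell e ≠ i ∧ (G.src e = v ∨ G.dst e = v))}

/-- The boundary `Γ(G,E) = ⋃ i, Γ(C_i)` of the partition. -/
def partitionBoundary {V E ι : Type} (G : RNGraph V E) (cell : E → ι) : Set V :=
  ⋃ i : ι, cellBoundary G cell i

/-- The distance from `u` to `v` using only walks whose edges lie in the edge set `A`: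
the minimum weight of such a walk, or `∞` if there is none. -/
noncomputable def distOn {V E : Type} (G : RNGraph V E) (w : E → ℝ) (A : Set E)
    (u v : V) : ℝ≥0∞ :=
  sInf {c | ∃ P : List E, G.IsWalkFrom u v P ∧ (∀ e ∈ P, e ∈ A) ∧
    c = ENNReal.ofReal (wsum w P)}

/-- The vertex set of `C_i^∞ = G[E_i] ∩ G^[∞]`: vertices incident with an edge of the
part `i` having unbounded scope level. -/
def cellInfVerts {V E ι : Type} (G : RNGraph V E) (S : E → ℕ∞) (cell : E → ι)
    (i : ι) : Set V :=
  {v | ∃ e, cell e = i ∧ S e = ⊤ ∧ (G.src e = v ∨ G.dst e = v)}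

/-- The weighting `p` of the (`S`-restricted) boundary graph `B_E`: for boundary
vertices `u, v` lying in a common cell `C_i` (more precisely, in
`Γ(C_i) ∩ V(C_i^∞)`), the minimum over all such cells `i` of the distance from `u`
to `v` within `C_i^∞` (this simplification keeps, of each bunch of parallel edges of
the in-cell distance graphs `D_i`, only one of smallest weight).  The value `∞` means
that `(u,v)` is not an edge of `B_E`. -/
noncomputable def bWeight {V E ι : Type} (G : RNGraph V E) (w : E → ℝ) (S : E → ℕ∞)
    (cell : E → ι) (u v : V) : ℝ≥0∞ :=
  ⨅ (i : ι) (_ : u ∈ cellBoundary G cell i ∩ cellInfVerts G S cell i)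
    (_ : v ∈ cellBoundary G cell i ∩ cellInfVerts G S cell i),
    distOn G w {e | cell e = i ∧ S e = ⊤} u v

/-- The cost of traversing, from `u`, the successive vertices of `L` in a weighted
graph with (extended-real-valued) weighting `p`. -/
noncomputable def chainCost {V : Type} (p : V → V → ℝ≥0∞) : V → List V → ℝ≥0∞
  | _, [] => 0
  | u, v :: L => p u v + chainCost p v L

/-- The distance from `s` to `t` in the weighted graph with weighting `p`
(where `p u v = ∞` encodes the absence of an edge from `u` to `v`):
the minimum total weight of a walk `s, v₁, …, vₖ = t`. -/
noncomputable def pDist {V : Type} (p : V → V → ℝ≥0∞) (s t : V) : ℝ≥0∞ :=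
  sInf {c | ∃ L : List V, (s :: L).getLast (List.cons_ne_nil s L) = t ∧
    c = chainCost p s L}

section Walks

variable {V E : Type} {G : RNGraph V E} {w : E → ℝ} {A B : Set E}

lemma RNGraph.IsWalkFrom.append {P Q : List E} {u v x : V} (hP : G.IsWalkFrom u v P)
    (hQ : G.IsWalkFrom v x Q) : G.IsWalkFrom u x (P ++ Q) := by
  induction P generalizing u with
  | nil => cases hP; exact hQ
  | cons e P ih => exact ⟨hP.1, ih hP.2⟩

lemma wsum_nonneg (hw : ∀ e, 0 ≤ w e) (P : List E) : 0 ≤ wsum w P :=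
  List.sum_nonneg (by simpa [wsum] using fun e _ => hw e)

lemma ofReal_wsum_append (hw : ∀ e, 0 ≤ w e) (P Q : List E) :
    ENNReal.ofReal (wsum w (P ++ Q)) =
      ENNReal.ofReal (wsum w P) + ENNReal.ofReal (wsum w Q) := by
  rw [← ENNReal.ofReal_add (wsum_nonneg hw P) (wsum_nonneg hw Q)]
  simp [wsum]

lemma distOn_le {P : List E} {u v : V} (hP : G.IsWalkFrom u v P) (hA : ∀ e ∈ P, e ∈ A) :
    distOn G w A u v ≤ ENNReal.ofReal (wsum w P) :=
  sInf_le ⟨P, hP, hA, rfl⟩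

lemma distOn_self (u : V) : distOn G w A u u = 0 :=
  nonpos_iff_eq_zero.1 <| by
    simpa [wsum] using distOn_le (G := G) (w := w) (A := A) (P := []) (u := u) rfl (by simp)

lemma distOn_mono (h : A ⊆ B) (u v : V) : distOn G w B u v ≤ distOn G w A u v := by
  refine le_sInf ?_
  rintro _ ⟨P, hP, hA, rfl⟩
  exact distOn_le hP fun e he => h (hA e he)

lemma distOn_triangle (hw : ∀ e, 0 ≤ w e) (u v x : V) :
    distOn G w A u x ≤ distOn G w A u v + distOn G w A v x := by
  rw [distOn, distOn.eq_def G w A u v, distOn.eq_def G w A v x, ENNReal.sInf_add]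
  refine le_iInf₂ ?_
  rintro _ ⟨P, hP, hPA, rfl⟩
  rw [add_comm, ENNReal.sInf_add]
  refine le_iInf₂ ?_
  rintro _ ⟨Q, hQ, hQA, rfl⟩
  rw [add_comm, ← ofReal_wsum_append hw]
  refine distOn_le (hP.append hQ) fun e he => ?_
  exact (List.mem_append.1 he).elim (hPA e) (hQA e)

lemma distOn_dst_le (hw : ∀ e, 0 ≤ w e) {e : E} (he : e ∈ A) (s : V) :
    distOn G w A s (G.dst e) ≤ distOn G w A s (G.src e) + ENNReal.ofReal (w e) := by
  refine (distOn_triangle hw s (G.src e) (G.dst e)).trans (add_le_add_right ?_ _)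
  simpa [wsum] using distOn_le (G := G) (w := w) (A := A) (P := [e]) ⟨rfl, rfl⟩ (by simpa)

end Walks

section Chains

variable {V : Type} (p : V → V → ℝ≥0∞)

lemma pDist_self (s : V) : pDist p s s = 0 :=
  nonpos_iff_eq_zero.1 <| sInf_le ⟨[], rfl, rfl⟩

lemma pDist_le_add (s u t : V) : pDist p s t ≤ p s u + pDist p u t := by
  rw [pDist, pDist.eq_def p u t, add_comm, ENNReal.sInf_add]
  refine le_iInf₂ ?_
  rintro _ ⟨L, hL, rfl⟩
  exact sInf_le ⟨u :: L, by simpa using hL, add_comm _ _⟩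

/-- A function satisfying the triangle inequality, vanishing on the diagonal and bounded by the
weighting is bounded by the distance of the weighting. -/
lemma le_pDist {d : V → V → ℝ≥0∞} (hself : ∀ u, d u u = 0)
    (htri : ∀ u v x, d u x ≤ d u v + d v x) (hle : ∀ u v, d u v ≤ p u v) (s t : V) :
    d s t ≤ pDist p s t := by
  refine le_sInf ?_
  rintro _ ⟨L, hL, rfl⟩
  induction L generalizing s with
  | nil => cases hL; simp [hself]
  | cons v L ih => exact (htri s v t).trans (add_le_add (hle s v) (ih v (by simpa using hL)))

end Chains

section Cells

variable {V E ι : Type} {G : RNGraph V E} {w : E → ℝ} {S : E → ℕ∞} {cell : E → ι}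

lemma mem_cellBoundary_of_ne {i : ι} {v : V} {e : E} (hv : v ∈ cellInfVerts G S cell i)
    (he : cell e ≠ i) (hev : G.src e = v ∨ G.dst e = v) : v ∈ cellBoundary G cell i := by
  obtain ⟨f, hf, -, hfv⟩ := hv
  exact ⟨⟨f, hf, hfv⟩, e, he, hev⟩

lemma mem_cellBoundary_of_mem_partitionBoundary {i : ι} {v : V}
    (hv : v ∈ cellInfVerts G S cell i) (hb : v ∈ partitionBoundary G cell) :
    v ∈ cellBoundary G cell i := by
  obtain ⟨j, hj⟩ := Set.mem_iUnion.1 hb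
  by_cases hij : j = i
  · exact hij ▸ hj
  · obtain ⟨⟨e, he, hev⟩, -⟩ := hj
    exact mem_cellBoundary_of_ne hv (he ▸ hij) hev

lemma bWeight_le {i : ι} {u v : V} (hu : u ∈ cellBoundary G cell i ∩ cellInfVerts G S cell i)
    (hv : v ∈ cellBoundary G cell i ∩ cellInfVerts G S cell i) :
    bWeight G w S cell u v ≤ distOn G w {e | cell e = i ∧ S e = ⊤} u v :=
  iInf_le_of_le i <| iInf₂_le hu hv

lemma distOn_top_le_bWeight (u v : V) :
    distOn G w {e | S e = ⊤} u v ≤ bWeight G w S cell u v :=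
  le_iInf fun _ => le_iInf₂ fun _ _ => distOn_mono (fun _ he => he.2) u v

/-- A walk of unbounded edges that continues a walk inside a cell `i`, started at a boundary vertex
`s` of this cell, is no shorter than the boundary graph distance. -/
lemma pDist_bWeight_le (hw : ∀ e, 0 ≤ w e) {t : V} (ht : t ∈ partitionBoundary G cell)
    {P : List E} (hS : ∀ e ∈ P, S e = ⊤) {i : ι} {s u : V}
    (hs : s ∈ cellBoundary G cell i ∩ cellInfVerts G S cell i)
    (hu : u ∈ cellInfVerts G S cell i) (hP : G.IsWalkFrom u t P) :
    pDist (bWeight G w S cell) s t ≤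
      distOn G w {e | cell e = i ∧ S e = ⊤} s u + ENNReal.ofReal (wsum w P) := by
  induction P generalizing i s u with
  | nil =>
    cases hP
    refine (pDist_le_add _ s t t).trans ?_
    rw [pDist_self]
    exact add_le_add
      (bWeight_le hs ⟨mem_cellBoundary_of_mem_partitionBoundary hu ht, hu⟩) zero_le
  | cons e P ih =>
    obtain ⟨rfl, hP⟩ := hP
    have heS : S e = ⊤ := hS e (by simp)
    have ih' := fun {s : V} hs => ih (fun f hf => hS f (by simp [hf])) (i := cell e) (s := s) hs
      ⟨e, rfl, heS, Or.inr rfl⟩ hP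
    have hsum : ENNReal.ofReal (wsum w (e :: P)) =
        ENNReal.ofReal (w e) + ENNReal.ofReal (wsum w P) := by
      simpa [wsum] using ofReal_wsum_append hw [e] P
    have step : ∀ {s : V}, s ∈ cellBoundary G cell (cell e) ∩ cellInfVerts G S cell (cell e) →
        pDist (bWeight G w S cell) s t ≤
          distOn G w {f | cell f = cell e ∧ S f = ⊤} s (G.src e) +
            ENNReal.ofReal (wsum w (e :: P)) := fun {s} hs => by
      rw [hsum, ← add_assoc]
      exact (ih' hs).trans (add_le_add_left (distOn_dst_le hw (A := {f | cell f = cell e ∧ S f = ⊤}) ⟨rfl, heS⟩ s) _)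
    by_cases hi : cell e = i
    · subst hi
      exact step hs
    · obtain ⟨f, hf, -, hfu⟩ := id hu
      have hsrc : G.src e ∈ cellInfVerts G S cell (cell e) := ⟨e, rfl, heS, Or.inl rfl⟩
      have hnext := step ⟨mem_cellBoundary_of_ne hsrc (hf ▸ Ne.symm hi) hfu, hsrc⟩
      rw [distOn_self, zero_add] at hnext
      exact (pDist_le_add _ s (G.src e) t).trans <| add_le_add
        (bWeight_le hs ⟨mem_cellBoundary_of_ne hu hi (Or.inl rfl), hu⟩) hnext

end Cells

/-- Proposition 1 of the paper. Let `(G,w)` be a road network, `S` a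
scope mapping of it, and `cell : E → ι` a partition of `E(G)` into parts
`E_i = cell⁻¹(i)`. For any `s, t ∈ Γ(G,E)`, the minimum weight of a walk from `s` to
`t` in `G^[∞]` equals the distance from `s` to `t` in the boundary graph `B_E` with
its weighting `p`. -/
theorem distOn_top_eq_boundary_dist {V E ι : Type} [Fintype E]
    (G : RNGraph V E) (w : E → ℝ) (hw : ∀ e, 0 ≤ w e)
    (S : E → ℕ∞) (h0 : 0 ∈ Set.range S) (htop : ⊤ ∈ Set.range S)
    (cell : E → ι) (hcell : Function.Surjective cell)
    (s t : V) (hs : s ∈ partitionBoundary G cell) (ht : t ∈ partitionBoundary G cell) :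
    distOn G w {e | S e = ⊤} s t = pDist (bWeight G w S cell) s t := by
  refine le_antisymm
    (le_pDist _ distOn_self (distOn_triangle hw) distOn_top_le_bWeight s t) (le_sInf ?_)
  rintro _ ⟨P, hP, hS, rfl⟩
  cases P with
  | nil => cases hP; simp [pDist_self]
  | cons e P =>
    have hse : s ∈ cellInfVerts G S cell (cell e) := ⟨e, rfl, hS e (by simp), Or.inl hP.1⟩
    simpa [distOn_self] using pDist_bWeight_le hw ht hS
      ⟨mem_cellBoundary_of_mem_partitionBoundary hse hs, hse⟩ hse hP
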